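/- arXiv:1102.3205 — 2 statements merged into one kernel-verified Lean document; each statement's English description precedes it below -/
import Mathlib

section
/- Let F ⊆ E be an extension of differential fields of characteristic zero with the same field of constants C, and suppose E = F(x₁, …, xₜ) is generated as a field over F by elements x₁, …, xₜ with xᵢ′ ∈ F for each i. Then an element x ∈ E satisfies x′ ∈ F if and only if there exist a tuple (c₁, …, cₜ) ∈ Cᵗ and an element f ∈ F such that x = Σᵢ cᵢ xᵢ + f. -/
open Polynomial
open scoped Differential

namespace Differential

section ImplicitDeriv

variable {F : Type*} [Field F] [Differential F] (b : F)

lemma coeff_implicitDeriv_C (p : F[X]) (n : ℕ) :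
    (implicitDeriv (C b) p).coeff n = (p.coeff n)′ + b * (p.coeff (n + 1) * (n + 1)) := by
  change (mapCoeffs p + C b * derivative p).coeff n = _
  rw [coeff_add, coeff_mapCoeffs, coeff_C_mul, coeff_derivative]

lemma degree_implicitDeriv_C_lt {p : F[X]} (hp : p.Monic) :
    (implicitDeriv (C b) p).degree < p.degree := by
  rw [degree_eq_natDegree hp.ne_zero, degree_lt_iff_coeff_zero]
  intro m hm
  rw [coeff_implicitDeriv_C, coeff_eq_zero_of_natDegree_lt (by lia : p.natDegree < m + 1)]
  rcases hm.eq_or_lt with rfl | h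
  · simp [hp]
  · simp [coeff_eq_zero_of_natDegree_lt h]

end ImplicitDeriv

variable {F E : Type*} [Field F] [Field E] [Algebra F E] [Differential F]
  [Differential E] [DifferentialAlgebra F E] [ContainConstants F E]

/-- Let `p` have degree `n + 1` and constant leading coefficient, and let `x` be an antiderivative
of `b`. If the coefficient of index `n` in the derivative of `p(x)` vanishes, then `x` lies in the
base field. -/
lemma mem_range_of_coeff_implicitDeriv_eq_zero [CharZero F] {x : E} {b : F}
    (hx : x′ = algebraMap F E b) {p : F[X]} {n : ℕ} (hn : p.natDegree = n + 1)
    (hlead : (p.coeff (n + 1))′ = 0)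
    (hcoeff : (implicitDeriv (C b) p).coeff n = 0) : x ∈ (algebraMap F E).range := by
  have hne : p.coeff (n + 1) ≠ 0 := by
    rw [← hn, coeff_natDegree, leadingCoeff_ne_zero]
    rintro rfl
    simp at hn
  set u : F := p.coeff (n + 1) * (n + 1) with hu
  have hu0 : u ≠ 0 := mul_ne_zero hne (by exact_mod_cast n.succ_ne_zero)
  have hu' : u′ = 0 := by
    have : ((n : F) + 1)′ = 0 := by simp
    rw [hu, Derivation.leibniz, hlead, this]
    simp
  have hconst : (algebraMap F E (p.coeff n) + algebraMap F E u * x)′ = 0 := by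
    rw [coeff_implicitDeriv_C] at hcoeff
    rw [map_add, Derivation.leibniz, deriv_algebraMap, deriv_algebraMap, hu', hx, map_zero,
      smul_zero, add_zero, smul_eq_mul, ← map_mul, ← map_add, mul_comm, hcoeff, map_zero]
  obtain ⟨g, hg⟩ := mem_range_of_deriv_eq_zero F hconst
  refine ⟨(g - p.coeff n) / u, ?_⟩
  have hu1 : algebraMap F E u ≠ 0 := by simpa using hu0
  rw [map_div₀, map_sub, hg]
  field_simp
  ring

/-- An algebraic antiderivative in a no new constants extension lies in the base field. -/
lemma mem_range_of_isAlgebraic [CharZero F] {x : E} {b : F} (hx : x′ = algebraMap F E b)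
    (halg : IsAlgebraic F x) : x ∈ (algebraMap F E).range := by
  have hmonic := minpoly.monic halg.isIntegral
  obtain ⟨n, hn⟩ := Nat.exists_eq_succ_of_ne_zero (minpoly.natDegree_pos halg.isIntegral).ne'
  refine mem_range_of_coeff_implicitDeriv_eq_zero hx hn ?_ ?_
  · rw [← Nat.succ_eq_add_one, ← hn, hmonic.coeff_natDegree, Derivation.map_one_eq_zero]
  · have hzero : implicitDeriv (C b) (minpoly F x) = 0 := by
      by_contra h
      refine (minpoly.degree_le_of_ne_zero F x h ?_).not_gt (degree_implicitDeriv_C_lt b hmonic)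
      rw [← deriv_aeval_eq_implicitDeriv x (C b) (by rw [hx, aeval_C]), minpoly.aeval, map_zero]
    rw [hzero, coeff_zero]

/-- A fraction `p(x) / q(x)` whose derivative lies in the base field is a polynomial in `x`. -/
lemma exists_eq_aeval_of_aeval_mul_eq {x y : E} {a b : F} (hx : x′ = algebraMap F E b)
    (hy : y′ = algebraMap F E a) (htr : Transcendental F x) (q p : F[X]) (hq : q ≠ 0)
    (h : aeval x q * y = aeval x p) : ∃ r : F[X], y = aeval x r := by
  induction hd : q.natDegree using Nat.strong_induction_on generalizing p q with
  | _ d ih =>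
  wlog hmonic : q.Monic generalizing p q
  · refine this (C q.leadingCoeff⁻¹ * q) (C q.leadingCoeff⁻¹ * p) ?_ ?_ ?_ ?_
    · simpa using hq
    · rw [map_mul, map_mul, mul_assoc, h]
    · rw [natDegree_C_mul (by simpa using hq), hd]
    · rw [mul_comm]
      exact monic_mul_leadingCoeff_inv hq
  have hderiv (r : F[X]) : (aeval x r)′ = aeval x (implicitDeriv (C b) r) :=
    deriv_aeval_eq_implicitDeriv x (C b) (by rw [hx, aeval_C]) r
  by_cases h0 : implicitDeriv (C b) q = 0
  · obtain ⟨g, hg⟩ := mem_range_of_deriv_eq_zero F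
      (show (aeval x q)′ = 0 by rw [hderiv, h0, map_zero])
    have hqx : aeval x q ≠ 0 := fun h => hq (transcendental_iff.mp htr q h)
    refine ⟨C g⁻¹ * p, ?_⟩
    rw [map_mul, ← h, aeval_C, map_inv₀, hg, inv_mul_cancel_left₀ hqx]
  · refine ih _ ?_ _ (implicitDeriv (C b) p - C a * q) h0 ?_ rfl
    · rw [← hd]
      exact natDegree_lt_natDegree h0 (degree_implicitDeriv_C_lt b hmonic)
    · have hmul := congrArg (fun z => z′) h
      simp only [Derivation.leibniz, hderiv, hy, smul_eq_mul] at hmul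
      rw [map_sub, map_mul, aeval_C, ← hmul]
      ring

/-- An antiderivative of `F` in the simple extension generated by an antiderivative `x` of `F` is
a constant multiple of `x` up to an element of `F`. -/
theorem exists_eq_mul_add_of_mem_adjoin_simple [CharZero F] {x y : E} {a b : F}
    (hx : x′ = algebraMap F E b) (hy : y′ = algebraMap F E a)
    (hmem : y ∈ IntermediateField.adjoin F {x}) :
    ∃ c f : F, c′ = 0 ∧ y = algebraMap F E c * x + algebraMap F E f := by
  by_cases hxF : x ∈ (algebraMap F E).range
  · have hbot : IntermediateField.adjoin F {x} = ⊥ := by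
      rw [IntermediateField.adjoin_simple_eq_bot_iff]
      exact IntermediateField.mem_bot.mpr hxF
    rw [hbot] at hmem
    obtain ⟨f, rfl⟩ := IntermediateField.mem_bot.mp hmem
    exact ⟨0, f, by simp⟩
  have htr : Transcendental F x := fun h => hxF (mem_range_of_isAlgebraic hx h)
  have hinj := transcendental_iff_injective.mp htr
  obtain ⟨r, rfl⟩ : ∃ r : F[X], y = aeval x r := by
    obtain ⟨p, q, rfl⟩ := (IntermediateField.mem_adjoin_simple_iff F y).mp hmem
    by_cases hq : q = 0
    · exact ⟨0, by simp [hq]⟩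
    · refine exists_eq_aeval_of_aeval_mul_eq hx hy htr q p hq (mul_div_cancel₀ _ ?_)
      exact fun h => hq (transcendental_iff.mp htr q h)
  have hr : implicitDeriv (C b) r = C a := hinj <| by
    rw [← deriv_aeval_eq_implicitDeriv x (C b) (by rw [hx, aeval_C]), hy, aeval_C]
  have hlead (n : ℕ) (hn : r.natDegree = n + 1) : (r.coeff (n + 1))′ = 0 := by
    have := congrArg (fun s => s.coeff (n + 1)) hr
    simpa [coeff_implicitDeriv_C, coeff_C,
      coeff_eq_zero_of_natDegree_lt (by lia : r.natDegree < n + 1 + 1)] using this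
  have hdeg : r.natDegree ≤ 1 := by
    by_contra! h
    obtain ⟨n, hn⟩ : ∃ n, r.natDegree = n + 1 + 1 := ⟨r.natDegree - 2, by lia⟩
    exact hxF (mem_range_of_coeff_implicitDeriv_eq_zero hx hn (hlead _ hn) (by simp [hr]))
  refine ⟨r.coeff 1, r.coeff 0, ?_, ?_⟩
  · rcases Nat.le_one_iff_eq_zero_or_eq_one.mp hdeg with h | h
    · rw [coeff_eq_zero_of_natDegree_lt (by lia), map_zero]
    · exact hlead 0 h
  · conv_lhs => rw [eq_X_add_C_of_natDegree_le_one hdeg]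
    simp

end Differential

namespace Subfield

variable {E : Type*} [Field E] [CharZero E] (D : Derivation ℚ E E)

/-- The field generated by a differential subfield and antiderivatives of it is differential. -/
lemma deriv_mem_closure_union {F : Subfield E} (hF : ∀ a ∈ F, D a ∈ F) {s : Set E}
    (hs : ∀ a ∈ s, D a ∈ F) {y : E} (hy : y ∈ closure (↑F ∪ s)) :
    D y ∈ closure (↑F ∪ s) := by
  have hle : ∀ a ∈ F, a ∈ closure (↑F ∪ s) := fun a ha => subset_closure (Or.inl ha)
  induction hy using closure_induction with
  | mem a ha => exact hle _ (ha.elim (hF a) (hs a))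
  | one => simp
  | add a b _ _ iha ihb => simpa using add_mem iha ihb
  | neg a _ iha => simpa using neg_mem iha
  | inv a ha iha =>
    rw [Derivation.leibniz_inv]
    exact mul_mem (neg_mem (pow_mem (inv_mem ha) 2)) iha
  | mul a b ha hb iha ihb =>
    rw [Derivation.leibniz]
    exact add_mem (mul_mem ha ihb) (mul_mem hb iha)

lemma exists_eq_mul_add_of_mem_closure_union_singleton {F : Subfield E}
    (hF : ∀ a ∈ F, D a ∈ F) (hC : ∀ c : E, D c = 0 → c ∈ F) {x y : E} (hx : D x ∈ F)
    (hy : D y ∈ F) (hmem : y ∈ closure (↑F ∪ {x})) :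
    ∃ c f : E, D c = 0 ∧ f ∈ F ∧ y = c * x + f := by
  let _ : Differential E := ⟨D.restrictScalars ℤ⟩
  let _ : Differential F := ⟨Derivation.mk'
    { toFun := fun a => ⟨D a, hF a a.2⟩
      map_add' := fun a b => by ext; simp
      map_smul' := fun n a => by ext; simp } (fun a b => by ext; simp)⟩
  have : DifferentialAlgebra F E := ⟨fun a => rfl⟩
  have : Differential.ContainConstants F E := ⟨fun {z} hz => ⟨⟨z, hC z hz⟩, rfl⟩⟩
  obtain ⟨c, f, hc, h⟩ := Differential.exists_eq_mul_add_of_mem_adjoin_simple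
    (F := F) (E := E) (x := x) (y := y) (b := ⟨D x, hx⟩) (a := ⟨D y, hy⟩) rfl rfl (by
      rw [← IntermediateField.mem_toSubfield, IntermediateField.adjoin_toSubfield]
      convert! hmem
      exact Subtype.range_coe)
  exact ⟨c, f, congrArg Subtype.val hc, f.2, h⟩

theorem exists_eq_sum_add_of_mem_closure_union_range {F : Subfield E}
    (hF : ∀ a ∈ F, D a ∈ F) (hC : ∀ c : E, D c = 0 → c ∈ F) {t : ℕ} {x : Fin t → E}
    (hx : ∀ i, D (x i) ∈ F) {y : E} (hy : D y ∈ F) (hmem : y ∈ closure (↑F ∪ Set.range x)) :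
    ∃ (c : Fin t → E) (f : E), (∀ i, D (c i) = 0) ∧ f ∈ F ∧ y = (∑ i, c i * x i) + f := by
  induction t generalizing F with
  | zero => exact ⟨0, y, by simp, by simpa [Set.range_eq_empty, closure_eq] using hmem, by simp⟩
  | succ t ih =>
    set F₁ : Subfield E := closure (↑F ∪ {x 0}) with hF₁
    have hle : ∀ a ∈ F, a ∈ F₁ := fun a ha => subset_closure (Or.inl ha)
    have hclosure : closure (↑F ∪ Set.range x) = closure (↑F₁ ∪ Set.range (Fin.tail x)) := by
      rw [closure_union (F₁ : Set E), closure_eq, hF₁, ← closure_union, Set.union_assoc,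
        ← Set.insert_eq, ← Fin.range_cons, Fin.cons_self_tail]
    obtain ⟨c, g, hc, hg, hsum⟩ := ih (F := F₁) (x := Fin.tail x)
      (fun a ha => deriv_mem_closure_union D hF (by simpa using hx 0) ha)
      (fun c h => hle _ (hC c h)) (fun i => hle _ (hx i.succ)) (hle _ hy) (hclosure ▸ hmem)
    have hDg : D g ∈ F := by
      have hg' : g = y - ∑ i, c i * Fin.tail x i := by rw [hsum]; ring
      rw [hg', map_sub, map_sum]
      refine sub_mem hy (sum_mem fun i _ => ?_)
      rw [Derivation.leibniz, hc, smul_zero, add_zero]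
      exact mul_mem (hC _ (hc i)) (hx i.succ)
    obtain ⟨c₀, f, hc₀, hf, rfl⟩ :=
      exists_eq_mul_add_of_mem_closure_union_singleton D hF hC (hx 0) hDg hg
    refine ⟨Fin.cons c₀ c, f, fun i => Fin.cases hc₀ hc i, hf, ?_⟩
    rw [hsum, Fin.sum_univ_succ]
    simp only [Fin.cons_zero, Fin.cons_succ, Fin.tail]
    ring

end Subfield

/-- Let `F ⊆ E` be an extension of differential fields of characteristic
zero with the same field of constants, and suppose `E = F(x₁, …, xₜ)` where `xᵢ′ ∈ F`.
Then `x ∈ E` satisfies `x′ ∈ F` iff `x = Σ cᵢ xᵢ + f` for some constants `cᵢ` and some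
`f ∈ F`. -/
theorem antiderivative_iff_constant_combination
    (E : Type) [Field E] [CharZero E] (D : Derivation ℚ E E)
    (F : Subfield E) (hF : ∀ a ∈ F, D a ∈ F)
    (hC : ∀ c : E, D c = 0 → c ∈ F)
    (t : ℕ) (x : Fin t → E) (hx : ∀ i, D (x i) ∈ F)
    (hgen : Subfield.closure (↑F ∪ Set.range x) = ⊤)
    (ξ : E) :
    D ξ ∈ F ↔
      ∃ (c : Fin t → E) (f : E), (∀ i, D (c i) = 0) ∧ f ∈ F ∧
        ξ = (∑ i, c i * x i) + f := by
  constructor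
  · intro hξ
    exact Subfield.exists_eq_sum_add_of_mem_closure_union_range D hF hC hx hξ (hgen ▸ trivial)
  · rintro ⟨c, f, hc, hf, rfl⟩
    rw [map_add, map_sum]
    refine add_mem (sum_mem fun i _ => ?_) (hF f hf)
    rw [Derivation.leibniz, hc, smul_zero, add_zero]
    exact mul_mem (hC _ (hc i)) (hx i)
end

section
/- Let K be a differential field of characteristic zero with field of constants C, and let K ⊆ K(x) be an extension of differential fields with the same constants, where x is transcendental over K and x′ ∈ K. Let S = Σᵢ₌₀ˢ qᵢ xⁱ ∈ K[x] with qᵢ ∈ K and qₛ ≠ 0. If there exists T ∈ K(x) with T′ = S, then T is a polynomial in x with coefficients in K, and the degree of T equals s or s + 1. -/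
open Polynomial Differential

/-- An element of `K(x)` is a quotient of coprime polynomials in `x` with monic denominator. -/
theorem exists_aeval_eq_div_of_isCoprime {K E : Type*} [Field K] [Field E] [Algebra K E]
    {x : E} (hxt : Transcendental K x) {T : E} (hT : T ∈ IntermediateField.adjoin K {x}) :
    ∃ p q : K[X], IsCoprime p q ∧ q.Monic ∧ T = aeval x p / aeval x q := by
  classical
  obtain ⟨r, s, rfl⟩ := (IntermediateField.mem_adjoin_simple_iff K T).1 hT
  rcases eq_or_ne s 0 with rfl | hs
  · exact ⟨0, 1, isCoprime_one_right, monic_one, by simp⟩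
  obtain ⟨g, hg⟩ : ∃ g, g = gcd r s := ⟨_, rfl⟩
  obtain ⟨p, q, hp, hq, hpq⟩ := extract_gcd r s
  rw [← hg] at hp hq
  have hinj {u : K[X]} (hu : u ≠ 0) : aeval x u ≠ 0 := fun h =>
    hu (transcendental_iff.1 hxt u h)
  have hg0 : g ≠ 0 := by rintro rfl; simp [hq] at hs
  have hq0 : q ≠ 0 := by rintro rfl; simp [hq] at hs
  have hc : q.leadingCoeff⁻¹ ≠ 0 := by simpa using hq0
  have hu : IsUnit (C q.leadingCoeff⁻¹) := isUnit_C.2 hc.isUnit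
  refine ⟨p * C q.leadingCoeff⁻¹, q * C q.leadingCoeff⁻¹, ?_, monic_mul_leadingCoeff_inv hq0, ?_⟩
  · rw [isCoprime_mul_unit_right hu]
    exact (gcd_isUnit_iff _ _).1 hpq
  · rw [hp, hq, map_mul, map_mul, mul_div_mul_left _ _ (hinj hg0), map_mul, map_mul,
      mul_div_mul_right _ _ (hinj hu.ne_zero)]

section PrimitiveExtension

variable {K E : Type*} [Field K] [Field E] [Algebra K E]
  [Differential K] [Differential E] [DifferentialAlgebra K E]

theorem Differential.coeff_implicitDeriv_C_s5 (b : K) (p : K[X]) (n : ℕ) :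
    (implicitDeriv (C b) p).coeff n = (p.coeff n)′ + b * (p.coeff (n + 1) * (n + 1)) := by
  simp [implicitDeriv, coeff_derivative]

theorem Differential.implicitDeriv_C_eq_of_aeval_eq {x : E} (hxt : Transcendental K x) {b : K}
    (hx : x′ = algebraMap K E b) {p q : K[X]} (h : (aeval x p)′ = aeval x q) :
    implicitDeriv (C b) p = q := by
  apply transcendental_iff_injective.1 hxt
  rw [← h, deriv_aeval_eq_implicitDeriv x (C b) (by simpa using hx)]

/-- Without new constants, a polynomial in `x` that is a constant has degree zero. -/
theorem Differential.natDegree_eq_zero_of_implicitDeriv_C_eq_zero [ContainConstants K E] {x : E}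
    (hxt : Transcendental K x) {b : K} (hx : x′ = algebraMap K E b) {p : K[X]}
    (h : implicitDeriv (C b) p = 0) : p.natDegree = 0 := by
  obtain ⟨c, hc⟩ := mem_range_of_deriv_eq_zero K (x := aeval x p) <| by
    rw [deriv_aeval_eq_implicitDeriv x (C b) (by simpa using hx), h, map_zero]
  rw [← aeval_C x c] at hc
  rw [← transcendental_iff_injective.1 hxt hc, natDegree_C]

/-- A monic polynomial dividing its own derivative is trivial. -/
theorem Differential.eq_one_of_monic_of_dvd_implicitDeriv_C [ContainConstants K E] {x : E}
    (hxt : Transcendental K x) {b : K} (hx : x′ = algebraMap K E b) {p : K[X]}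
    (hp : p.Monic) (h : p ∣ implicitDeriv (C b) p) : p = 1 := by
  refine hp.natDegree_eq_zero.1 (natDegree_eq_zero_of_implicitDeriv_C_eq_zero hxt hx ?_)
  refine eq_zero_of_dvd_of_degree_lt h ?_
  rw [degree_eq_natDegree hp.ne_zero, degree_lt_iff_coeff_zero]
  intro m hm
  rw [coeff_implicitDeriv_C_s5, coeff_eq_zero_of_natDegree_lt (n := m + 1) (by lia)]
  rcases hm.eq_or_lt with rfl | hm
  · simp [hp.coeff_natDegree]
  · simp [coeff_eq_zero_of_natDegree_lt hm]

/-- If a rational function in `x` has a derivative that is polynomial in `x`, it is itself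
polynomial in `x`. -/
theorem Differential.exists_aeval_eq_of_deriv_eq_aeval [ContainConstants K E] {x : E}
    (hxt : Transcendental K x) {b : K} (hx : x′ = algebraMap K E b) {T : E}
    (hT : T ∈ IntermediateField.adjoin K {x}) {S : K[X]} (h : T′ = aeval x S) :
    ∃ p : K[X], T = aeval x p := by
  obtain ⟨p, q, hpq, hq, rfl⟩ := exists_aeval_eq_div_of_isCoprime hxt hT
  have hq0 : aeval x q ≠ 0 := fun h => hq.ne_zero (transcendental_iff.1 hxt q h)
  have hx' : x′ = aeval x (C b) := by simpa using hx
  have key : aeval x (implicitDeriv (C b) p) =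
      aeval x (S * q) + aeval x p / aeval x q * aeval x (implicitDeriv (C b) q) := by
    have := congrArg deriv (div_mul_cancel₀ (aeval x p) hq0)
    rw [Derivation.leibniz, h, deriv_aeval_eq_implicitDeriv x (C b) hx',
      deriv_aeval_eq_implicitDeriv x (C b) hx', smul_eq_mul, smul_eq_mul] at this
    rw [← this, map_mul]
    ring
  have hpoly : implicitDeriv (C b) p * q = S * q * q + p * implicitDeriv (C b) q := by
    apply transcendental_iff_injective.1 hxt
    simp only [map_mul, map_add] at key ⊢
    rw [key]
    field_simp
  have hdvd : q ∣ p * implicitDeriv (C b) q :=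
    ⟨implicitDeriv (C b) p - S * q, by linear_combination -hpoly⟩
  have := eq_one_of_monic_of_dvd_implicitDeriv_C hxt hx hq (hpq.symm.dvd_of_dvd_mul_left hdvd)
  exact ⟨p, by simp [this]⟩

theorem Differential.natDegree_eq_or_eq_succ_of_implicitDeriv_C [CharZero K]
    [ContainConstants K E] {x : E} (hxt : Transcendental K x) {b : K}
    (hx : x′ = algebraMap K E b) {p : K[X]} (hp : implicitDeriv (C b) p ≠ 0) :
    p.natDegree = (implicitDeriv (C b) p).natDegree ∨
      p.natDegree = (implicitDeriv (C b) p).natDegree + 1 := by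
  have hle : (implicitDeriv (C b) p).natDegree ≤ p.natDegree := by
    refine natDegree_le_iff_coeff_eq_zero.2 fun m hm => ?_
    simp [coeff_implicitDeriv_C_s5, coeff_eq_zero_of_natDegree_lt hm,
      coeff_eq_zero_of_natDegree_lt (hm.trans m.lt_succ_self)]
  by_contra! hne
  obtain ⟨n, hn⟩ : ∃ n, p.natDegree = n + 1 := Nat.exists_eq_succ_of_ne_zero (by lia)
  have hlead : (p.coeff (n + 1))′ = 0 := by
    have := coeff_eq_zero_of_natDegree_lt (p := implicitDeriv (C b) p) (n := n + 1) (by lia)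
    rwa [coeff_implicitDeriv_C_s5, coeff_eq_zero_of_natDegree_lt (n := n + 1 + 1) (by lia),
      zero_mul, mul_zero, add_zero] at this
  have hnext : (p.coeff n)′ + b * (p.coeff (n + 1) * (n + 1)) = 0 := by
    rw [← coeff_implicitDeriv_C_s5]
    exact coeff_eq_zero_of_natDegree_lt (by lia)
  have ha : p.coeff (n + 1) * (n + 1) ≠ 0 := by
    refine mul_ne_zero ?_ n.cast_add_one_ne_zero
    rw [← hn, coeff_natDegree, leadingCoeff_ne_zero]
    rintro rfl
    simp at hp
  have hlin : implicitDeriv (C b) (C (p.coeff (n + 1) * (n + 1)) * X + C (p.coeff n)) = 0 := by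
    have hcast : ((n : K) + 1)′ = 0 := by
      simp
    rw [map_add, Derivation.leibniz, implicitDeriv_C, implicitDeriv_C, implicitDeriv_X,
      Derivation.leibniz, hlead, hcast]
    simp only [smul_eq_mul, mul_zero, add_zero, C_0, ← C_mul, ← C_add]
    rw [mul_comm _ b, add_comm, hnext, C_0]
  have := natDegree_eq_zero_of_implicitDeriv_C_eq_zero hxt hx hlin
  rw [natDegree_linear ha] at this
  exact one_ne_zero this

end PrimitiveExtension

/-- Let `K ⊆ K(x)` be an extension of differential fields of
characteristic zero with the same constants, with `x` transcendental over `K` and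
`x′ ∈ K`.  Let `S = Σᵢ₌₀ˢ qᵢ xⁱ` with `qᵢ ∈ K`, `qₛ ≠ 0`.  If `T ∈ K(x)` satisfies
`T′ = S`, then `T` is a polynomial in `x` over `K` of degree `s` or `s + 1`. -/
theorem integral_of_polynomial_is_polynomial
    (E : Type) [Field E] [CharZero E] (D : Derivation ℚ E E)
    (K : Subfield E) (hK : ∀ a ∈ K, D a ∈ K)
    (hC : ∀ c : E, D c = 0 → c ∈ K)
    (x : E) (hxt : Transcendental K x) (hx : D x ∈ K)
    (hgen : Subfield.closure (↑K ∪ {x}) = ⊤)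
    (s : ℕ) (q : ℕ → E) (hq : ∀ i ≤ s, q i ∈ K) (hqs : q s ≠ 0)
    (T : E) (hT : D T = ∑ i ∈ Finset.range (s + 1), q i * x ^ i) :
    ∃ (t : ℕ) (r : ℕ → E), (∀ i ≤ t, r i ∈ K) ∧ r t ≠ 0 ∧
      T = ∑ i ∈ Finset.range (t + 1), r i * x ^ i ∧ (t = s ∨ t = s + 1) := by
  let : Differential E := ⟨D.restrictScalars ℤ⟩
  let : Differential K := ⟨Derivation.mk'
    { toFun := fun a => (⟨D a, hK a a.2⟩ : K)
      map_add' := fun a b => by ext; simp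
      map_smul' := fun m a => by ext; simp }
    fun a b => by ext; simp⟩
  have : DifferentialAlgebra K E := ⟨fun _ => rfl⟩
  have : ContainConstants K E := ⟨fun {c} hc => ⟨⟨c, hC c hc⟩, rfl⟩⟩
  have hTmem : T ∈ IntermediateField.adjoin K {x} := by
    rw [← IntermediateField.mem_toSubfield, IntermediateField.adjoin_toSubfield]
    have : Set.range (algebraMap K E) = K := Subtype.range_coe
    rw [this, hgen]
    trivial
  obtain ⟨a, ha⟩ : ∃ a : ℕ → K, ∀ i ≤ s, (a i : E) = q i :=
    ⟨fun i => if h : i ≤ s then ⟨q i, hq i h⟩ else 0, fun i h => by simp [h]⟩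
  obtain ⟨S, hS⟩ : ∃ S : K[X], S = ∑ i ∈ Finset.range (s + 1), monomial i (a i) := ⟨_, rfl⟩
  have hcoeff (n : ℕ) : S.coeff n = if n ≤ s then a n else 0 := by
    simp [hS, coeff_monomial]
  have has : a s ≠ 0 := fun h => hqs (by rw [← ha s le_rfl, h]; rfl)
  have hSdeg : S.natDegree = s := by
    refine natDegree_eq_of_le_of_coeff_ne_zero ?_ (by simpa [hcoeff] using has)
    refine natDegree_le_iff_coeff_eq_zero.2 fun m hm => ?_
    simp [hcoeff, hm.not_ge]
  have hTS : T′ = aeval x S := by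
    refine hT.trans ?_
    rw [hS, map_sum]
    refine Finset.sum_congr rfl fun i hi => ?_
    rw [aeval_monomial, ← ha i (Nat.lt_succ_iff.1 (Finset.mem_range.1 hi))]
    rfl
  have hxb : x′ = algebraMap K E ⟨D x, hx⟩ := rfl
  obtain ⟨p, rfl⟩ := exists_aeval_eq_of_deriv_eq_aeval hxt hxb hTmem hTS
  have hpS := implicitDeriv_C_eq_of_aeval_eq hxt hxb hTS
  have hS0 : S ≠ 0 := fun h => has (by simpa [h] using (hcoeff s).symm)
  have hp0 : p ≠ 0 := by
    rintro rfl
    exact hS0 (by rw [← hpS, map_zero])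
  have hdeg := natDegree_eq_or_eq_succ_of_implicitDeriv_C hxt hxb (hpS ▸ hS0)
  rw [hpS, hSdeg] at hdeg
  refine ⟨p.natDegree, fun i => p.coeff i, fun i _ => (p.coeff i).2, ?_, ?_, hdeg⟩
  · simpa using hp0
  · rw [aeval_eq_sum_range]
    rfl
end
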